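/- arXiv:2509.16716 — 2 statements merged into one kernel-verified Lean document; each statement's English description precedes it below -/
import Mathlib

section
/- Let α, β > −1 be real and n ≥ 1 an integer. Let x₁, …, x_n be distinct points of (−1, 1) and w₁^R, …, w_n^R real numbers such that for every real polynomial p with deg p ≤ 2n − 1, ∫_{−1}^{1} p(x)·(1 − x)^{α}·(1 + x)^{β+1} dx = Σ_{i=1}^n w_i^R·p(x_i). Set w₀ = 2^{α+β+1}·Γ(β + 1)·Γ(β + 2)·Γ(n + 1)·Γ(n + α + 1)/(Γ(n + β + 2)·Γ(n + α + β + 2)) and w_i = w_i^R/(1 + x_i) for i = 1, …, n. Then for every real polynomial p with deg p ≤ 2n, ∫_{−1}^{1} p(x)·(1 − x)^{α}·(1 + x)^{β} dx = w₀·p(−1) + Σ_{i=1}^n w_i·p(x_i). (Gauss–Jacobi–Radau quadrature with fixed node −1 has maximal degree of exactness 2n.) -/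
open Set

/-- The moments of the Jacobi weight about its left endpoint. -/
lemma integral_jacobiWeight {α γ : ℝ} (hα : -1 < α) (hγ : -1 < γ) :
    ∫ t in (-1 : ℝ)..1, (1 - t) ^ α * (1 + t) ^ γ
      = 2 ^ (α + γ + 1) * Real.Gamma (α + 1) * Real.Gamma (γ + 1) / Real.Gamma (α + γ + 2) := by
  have key := Complex.betaIntegral_scaled ((γ + 1 : ℝ) : ℂ) ((α + 1 : ℝ) : ℂ) (a := 2) two_pos
  rw [Complex.betaIntegral_eq_Gamma_mul_div _ _ (by simpa using by linarith)
    (by simpa using by linarith), ← Complex.ofReal_add, Complex.Gamma_ofReal, Complex.Gamma_ofReal,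
    Complex.Gamma_ofReal] at key
  have hshift : ∫ t in (-1 : ℝ)..1, (1 - t) ^ α * (1 + t) ^ γ
      = ∫ s in (0 : ℝ)..2, s ^ γ * (2 - s) ^ α := by
    have := intervalIntegral.integral_comp_add_right (a := -1) (b := 1)
      (fun s : ℝ => s ^ γ * (2 - s) ^ α) 1
    norm_num at this
    rw [← this]
    refine intervalIntegral.integral_congr fun t _ => ?_
    rw [mul_comm, add_comm 1 t, show 2 - (t + 1) = 1 - t by ring]
  have hcast : ∫ x in (0 : ℝ)..2, (x : ℂ) ^ (((γ + 1 : ℝ) : ℂ) - 1)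
        * (((2 : ℝ) : ℂ) - x) ^ (((α + 1 : ℝ) : ℂ) - 1)
      = ((∫ s in (0 : ℝ)..2, s ^ γ * (2 - s) ^ α : ℝ) : ℂ) := by
    rw [← intervalIntegral.integral_ofReal]
    refine intervalIntegral.integral_congr fun x hx => ?_
    rw [uIcc_of_le zero_le_two] at hx
    simp only [Complex.ofReal_mul, Complex.ofReal_cpow hx.1,
      Complex.ofReal_cpow (sub_nonneg.2 hx.2)]
    push_cast
    congr 2 <;> ring
  rw [hcast, ← hshift] at key
  have h2 : ((2 : ℝ) : ℂ) ^ (((γ + 1 + (α + 1) : ℝ) : ℂ) - 1)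
      = (((2 : ℝ) ^ (α + γ + 1) : ℝ) : ℂ) := by
    rw [Complex.ofReal_cpow zero_le_two]
    congr 1
    push_cast
    ring
  rw [h2] at key
  have := Complex.ofReal_injective (key.trans (by push_cast; rfl :
    _ = (((2 : ℝ) ^ (α + γ + 1) * (Real.Gamma (γ + 1) * Real.Gamma (α + 1)
      / Real.Gamma (γ + 1 + (α + 1))) : ℝ) : ℂ)))
  rw [this, show γ + 1 + (α + 1) = α + γ + 2 by ring]
  ring

lemma intervalIntegrable_jacobiWeight {α γ : ℝ} (hα : -1 < α) (hγ : -1 < γ) :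
    IntervalIntegrable (fun t : ℝ => (1 - t) ^ α * (1 + t) ^ γ) MeasureTheory.volume (-1) 1 := by
  by_contra h
  have h0 := integral_jacobiWeight hα hγ
  rw [intervalIntegral.integral_undef h] at h0
  have h1 := Real.Gamma_pos_of_pos (show 0 < α + 1 by linarith)
  have h2 := Real.Gamma_pos_of_pos (show 0 < γ + 1 by linarith)
  have h3 := Real.Gamma_pos_of_pos (show 0 < α + γ + 2 by linarith)
  exact absurd h0 (by positivity)

lemma intervalIntegrable_polynomial_mul_jacobiWeight {α γ : ℝ} (hα : -1 < α) (hγ : -1 < γ)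
    (p : Polynomial ℝ) :
    IntervalIntegrable (fun t : ℝ => p.eval t * (1 - t) ^ α * (1 + t) ^ γ)
      MeasureTheory.volume (-1) 1 := by
  simp_rw [mul_assoc]
  exact (intervalIntegrable_jacobiWeight hα hγ).continuousOn_mul p.continuous.continuousOn

lemma integral_sq_polynomial_mul_jacobiWeight_pos {α γ : ℝ} (hα : -1 < α) (hγ : -1 < γ)
    {p : Polynomial ℝ} (hp : p ≠ 0) :
    0 < ∫ t in (-1 : ℝ)..1, (p ^ 2).eval t * (1 - t) ^ α * (1 + t) ^ γ := by
  rw [intervalIntegral.integral_pos_iff_support_of_nonneg_ae' _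
    (intervalIntegrable_polynomial_mul_jacobiWeight hα hγ _)]
  · refine ⟨by norm_num, ?_⟩
    have hvol : 0 < MeasureTheory.volume (Ioo (-1 : ℝ) 1 \ p.rootSet ℝ) := by
      rw [MeasureTheory.measure_sdiff_null ((p.rootSet_finite ℝ).measure_zero _)]
      simp
    refine hvol.trans_le (MeasureTheory.measure_mono fun t ht => ⟨?_, ht.1.1, ht.1.2.le⟩)
    have hroot : p.eval t ≠ 0 := fun h => ht.2 (by simp [Polynomial.mem_rootSet, hp, h])
    have h1 : 0 < 1 - t := by linarith [ht.1.2]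
    have h2 : 0 < 1 + t := by linarith [ht.1.1]
    rw [Function.mem_support, Polynomial.eval_pow]
    positivity
  · refine (MeasureTheory.ae_restrict_mem measurableSet_uIoc).mono fun t ht => ?_
    rw [uIoc_of_le (by norm_num)] at ht
    have h1 : 0 ≤ 1 - t := by linarith [ht.2]
    have h2 : 0 ≤ 1 + t := by linarith [ht.1]
    simp only [Pi.zero_apply, Polynomial.eval_pow]
    positivity

open Polynomial in
/-- Moments of a polynomial expanded in powers of `(1 + X) / 2`. -/
lemma integral_sum_mul_jacobiWeight {α γ : ℝ} (hα : -1 < α) (hγ : -1 < γ) (m : ℕ) (c : ℕ → ℝ) :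
    ∫ t in (-1 : ℝ)..1, (∑ k ∈ Finset.range m, C (c k / 2 ^ k) * (1 + X) ^ k).eval t
        * (1 - t) ^ α * (1 + t) ^ γ
      = 2 ^ (α + γ + 1) * Real.Gamma (α + 1) * ∑ k ∈ Finset.range m,
          c k * (Real.Gamma (γ + k + 1) / Real.Gamma (α + γ + k + 2)) := by
  have hterm (k : ℕ) : -1 < γ + k := by linarith [k.cast_nonneg (α := ℝ)]
  have hcongr : ∫ t in (-1 : ℝ)..1, (∑ k ∈ Finset.range m, C (c k / 2 ^ k) * (1 + X) ^ k).eval t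
        * (1 - t) ^ α * (1 + t) ^ γ
      = ∫ t in (-1 : ℝ)..1, ∑ k ∈ Finset.range m,
          c k / 2 ^ k * ((1 - t) ^ α * (1 + t) ^ (γ + k)) := by
    refine intervalIntegral.integral_congr_Ioo_of_le (by norm_num) fun t ht => ?_
    simp only [eval_finsetSum, eval_mul, eval_C, eval_pow, eval_add, eval_one, eval_X,
      Finset.sum_mul]
    refine Finset.sum_congr rfl fun k _ => ?_
    rw [Real.rpow_add (by linarith [ht.1]), Real.rpow_natCast]
    ring
  rw [hcongr, intervalIntegral.integral_finsetSum fun k _ =>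
    (intervalIntegrable_jacobiWeight hα (hterm k)).const_mul _, Finset.mul_sum]
  refine Finset.sum_congr rfl fun k _ => ?_
  rw [intervalIntegral.integral_const_mul, integral_jacobiWeight hα (hterm k),
    show α + (γ + k) + 1 = α + γ + 1 + k by ring, Real.rpow_add two_pos, Real.rpow_natCast,
    ← add_assoc α γ]
  field_simp

lemma Real.Gamma_add_nat_eq_ascPochhammer {x : ℝ} (hx : 0 < x) (m : ℕ) :
    Real.Gamma (x + m) = (ascPochhammer ℝ m).eval x * Real.Gamma x := by
  induction m with
  | zero => simp
  | succ m ih =>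
    rw [Nat.cast_succ, ← add_assoc, Real.Gamma_add_one (by positivity), ih,
      ascPochhammer_succ_eval]
    ring

open Polynomial in
lemma Polynomial.sum_neg_one_pow_choose_mul_eval_eq_zero {p : ℝ[X]} {n : ℕ}
    (hp : p.natDegree < n) (y : ℝ) :
    ∑ k ∈ Finset.range (n + 1), (-1) ^ k * (n.choose k : ℝ) * p.eval (y + k) = 0 := by
  have h := congrFun (Polynomial.fwdDiff_iter_eq_zero_of_degree_lt hp) y
  rw [fwdDiff_iter_eq_sum_shift] at h
  have h' := congrArg ((-1 : ℝ) ^ n * ·) h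
  simp only [Finset.mul_sum, Pi.zero_apply, mul_zero] at h'
  rw [← h']
  refine Finset.sum_congr rfl fun k hk => ?_
  have hk : k ≤ n := by simpa [Nat.lt_succ_iff] using hk
  have hsign : (-1 : ℝ) ^ n * (-1) ^ (n - k) = (-1) ^ k := by
    obtain ⟨d, rfl⟩ := Nat.exists_eq_add_of_le hk
    rw [Nat.add_sub_cancel_left, pow_add, mul_assoc, ← pow_add, ← two_mul, pow_mul]
    simp
  simp only [nsmul_eq_mul, mul_one, zsmul_eq_mul]
  push_cast
  rw [← hsign]
  ring

lemma sum_neg_one_pow_choose_div (n : ℕ) {y : ℝ} (hy : 0 < y) :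
    ∑ k ∈ Finset.range (n + 1), (-1) ^ k * (n.choose k : ℝ) / (y + k)
      = n.factorial / (ascPochhammer ℝ (n + 1)).eval y := by
  induction n generalizing y with
  | zero => simp
  | succ n ih =>
    have hrec : ∑ k ∈ Finset.range (n + 1 + 1), (-1) ^ k * ((n + 1).choose k : ℝ) / (y + k)
        = ∑ k ∈ Finset.range (n + 1), (-1) ^ k * (n.choose k : ℝ) / (y + k)
          - ∑ k ∈ Finset.range (n + 1), (-1) ^ k * (n.choose k : ℝ) / (y + 1 + k) := by
      have hlast : ∑ k ∈ Finset.range (n + 1), (-1) ^ k * (n.choose k : ℝ) / (y + k)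
          = ∑ k ∈ Finset.range (n + 1 + 1), (-1) ^ k * (n.choose k : ℝ) / (y + k) := by
        rw [Finset.sum_range_succ _ (n + 1)]
        simp
      rw [hlast, Finset.sum_range_succ' _ (n + 1), Finset.sum_range_succ' _ (n + 1),
        add_sub_right_comm, ← Finset.sum_sub_distrib]
      congr 1
      · refine Finset.sum_congr rfl fun k _ => ?_
        rw [Nat.choose_succ_succ]
        push_cast
        rw [show y + 1 + (k : ℝ) = y + (k + 1) by ring]
        ring
      · simp
    have hpos := ascPochhammer_pos n (y + 1) (by linarith)
    have hleft (m : ℕ) : (ascPochhammer ℝ (m + 1)).eval y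
        = y * (ascPochhammer ℝ m).eval (y + 1) := by
      simp [ascPochhammer_succ_left]
    rw [hrec, ih hy, ih (by linarith), hleft (n + 1), hleft n, ascPochhammer_succ_eval,
      Nat.factorial_succ]
    have : y + 1 + n ≠ 0 := by positivity
    push_cast
    field_simp
    ring

open Polynomial in
lemma Polynomial.sum_neg_one_pow_choose_mul_eval_div {p : ℝ[X]} {n : ℕ}
    (hp : p.natDegree ≤ n) {y : ℝ} (hy : 0 < y) :
    ∑ k ∈ Finset.range (n + 1), (-1) ^ k * (n.choose k : ℝ) * p.eval (y + k) / (y + k)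
      = p.eval 0 * n.factorial / (ascPochhammer ℝ (n + 1)).eval y := by
  have hsplit (k : ℕ) : (-1) ^ k * (n.choose k : ℝ) * p.eval (y + k) / (y + k)
      = p.eval 0 * ((-1) ^ k * (n.choose k : ℝ) / (y + k))
        + (-1) ^ k * (n.choose k : ℝ) * p.divX.eval (y + k) := by
    have h := congrArg (eval (y + k)) p.divX_mul_X_add
    simp only [eval_add, eval_mul, eval_X, eval_C, coeff_zero_eq_eval_zero] at h
    rw [← h]
    have : y + k ≠ 0 := by positivity
    field_simp
    ring
  have hrem : ∑ k ∈ Finset.range (n + 1), (-1) ^ k * (n.choose k : ℝ) * p.divX.eval (y + k)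
      = 0 := by
    rcases Nat.eq_zero_or_pos n with rfl | hn
    · rw [eq_C_of_natDegree_le_zero hp]
      simp
    · exact sum_neg_one_pow_choose_mul_eval_eq_zero
        (by rw [natDegree_divX_eq_natDegree_tsub_one]; omega) y
  rw [Finset.sum_congr rfl fun k _ => hsplit k, Finset.sum_add_distrib, hrem, ← Finset.mul_sum,
    sum_neg_one_pow_choose_div n hy, add_zero, mul_div_assoc]

open Polynomial in
/-- A scalar multiple of the Jacobi polynomial of degree `n` with parameters `(α, γ)`, expanded
about the left endpoint `-1`. -/
noncomputable def scaledJacobi (α γ : ℝ) (n : ℕ) : ℝ[X] :=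
  ∑ k ∈ Finset.range (n + 1),
    C ((-1) ^ k * (n.choose k : ℝ)
      * (Real.Gamma (n + α + γ + 1 + k) / Real.Gamma (γ + 1 + k)) / 2 ^ k) * (1 + X) ^ k

open Polynomial in
lemma natDegree_scaledJacobi_le (α γ : ℝ) (n : ℕ) : (scaledJacobi α γ n).natDegree ≤ n := by
  refine natDegree_sum_le_of_forall_le _ _ fun k hk => (natDegree_C_mul_le _ _).trans ?_
  have hX : (1 + X : ℝ[X]).natDegree ≤ 1 := by compute_degree
  calc ((1 + X : ℝ[X]) ^ k).natDegree ≤ k * 1 := natDegree_pow_le_of_le k hX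
    _ ≤ n := by have := Finset.mem_range.1 hk; omega

open Polynomial in
lemma eval_neg_one_scaledJacobi (α γ : ℝ) (n : ℕ) :
    (scaledJacobi α γ n).eval (-1) = Real.Gamma (n + α + γ + 1) / Real.Gamma (γ + 1) := by
  rw [scaledJacobi, Finset.sum_range_succ', eval_add, eval_finsetSum]
  simp

open Polynomial in
lemma integral_scaledJacobi_mul_pow_eq_zero {α γ : ℝ} (hα : -1 < α) (hγ : -1 < γ) {n j : ℕ}
    (hj : j < n) :
    ∫ t in (-1 : ℝ)..1, (scaledJacobi α γ n * (1 + X) ^ j).eval t * (1 - t) ^ α * (1 + t) ^ γ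
      = 0 := by
  have hcongr : ∫ t in (-1 : ℝ)..1,
        (scaledJacobi α γ n * (1 + X) ^ j).eval t * (1 - t) ^ α * (1 + t) ^ γ
      = ∫ t in (-1 : ℝ)..1,
        (scaledJacobi α γ n).eval t * (1 - t) ^ α * (1 + t) ^ (γ + j) := by
    refine intervalIntegral.integral_congr_Ioo_of_le (by norm_num) fun t ht => ?_
    simp only [eval_mul, eval_pow, eval_add, eval_one, eval_X]
    rw [Real.rpow_add (by linarith [ht.1]), Real.rpow_natCast]
    ring
  obtain ⟨d, rfl⟩ := Nat.exists_eq_add_of_lt hj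
  set p : ℝ[X] := (ascPochhammer ℝ j).comp (X + C (γ + 1))
    * (ascPochhammer ℝ d).comp (X + C (α + γ + j + 2)) with hp
  have hdeg : p.natDegree < j + d + 1 := by
    refine (natDegree_mul_le.trans ?_).trans_lt (Nat.lt_succ_self _)
    simp only [natDegree_comp, ascPochhammer_natDegree, natDegree_X_add_C, mul_one, le_refl]
  rw [hcongr, scaledJacobi, integral_sum_mul_jacobiWeight hα
    (by linarith [j.cast_nonneg (α := ℝ)] : -1 < γ + j), mul_eq_zero]
  right
  rw [← Polynomial.sum_neg_one_pow_choose_mul_eval_eq_zero hdeg 0]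
  refine Finset.sum_congr rfl fun k _ => ?_
  have hk := k.cast_nonneg (α := ℝ)
  have hj' := j.cast_nonneg (α := ℝ)
  have h1 : 0 < γ + 1 + k := by linarith
  have h2 : 0 < α + γ + j + k + 2 := by linarith
  have hG1 := (Real.Gamma_pos_of_pos h1).ne'
  have hG2 := (Real.Gamma_pos_of_pos h2).ne'
  have e1 := Real.Gamma_add_nat_eq_ascPochhammer h1 j
  have e2 := Real.Gamma_add_nat_eq_ascPochhammer h2 d
  rw [show γ + 1 + k + j = γ + j + k + 1 by ring] at e1
  rw [show α + γ + j + k + 2 + d = ((j + d + 1 : ℕ) : ℝ) + α + γ + 1 + k by push_cast; ring] at e2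
  rw [e2, show α + (γ + j) + k + 2 = α + γ + j + k + 2 by ring, e1, hp]
  simp only [eval_mul, eval_comp, eval_add, eval_X, eval_C, zero_add]
  rw [show (k : ℝ) + (γ + 1) = γ + 1 + k by ring,
    show (k : ℝ) + (α + γ + j + 2) = α + γ + j + k + 2 by ring]
  field_simp

open Polynomial in
lemma integral_scaledJacobi_lower_weight {α β : ℝ} (hα : -1 < α) (hβ : -1 < β) (n : ℕ) :
    ∫ t in (-1 : ℝ)..1, (scaledJacobi α (β + 1) n).eval t * (1 - t) ^ α * (1 + t) ^ β
      = 2 ^ (α + β + 1) * Real.Gamma (β + 1) * Real.Gamma (n + 1) * Real.Gamma (n + α + 1)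
        / Real.Gamma (n + β + 2) := by
  have hβ1 : 0 < β + 1 := by linarith
  have hα1 : 0 < α + 1 := by linarith
  have hsum : ∑ k ∈ Finset.range (n + 1), (-1) ^ k * (n.choose k : ℝ)
        * (Real.Gamma (n + α + (β + 1) + 1 + k) / Real.Gamma (β + 1 + 1 + k))
        * (Real.Gamma (β + k + 1) / Real.Gamma (α + β + k + 2))
      = ∑ k ∈ Finset.range (n + 1), (-1) ^ k * (n.choose k : ℝ)
        * ((ascPochhammer ℝ n).comp (X + C (α + 1))).eval (β + 1 + k) / (β + 1 + k) := by
    refine Finset.sum_congr rfl fun k _ => ?_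
    have hk := k.cast_nonneg (α := ℝ)
    have h1 : 0 < β + 1 + k := by linarith
    have h2 : 0 < α + β + k + 2 := by linarith
    have hG1 := (Real.Gamma_pos_of_pos h1).ne'
    have hG2 := (Real.Gamma_pos_of_pos h2).ne'
    have e1 := Real.Gamma_add_one h1.ne'
    have e2 := Real.Gamma_add_nat_eq_ascPochhammer h2 n
    rw [show (n : ℝ) + α + (β + 1) + 1 + k = α + β + k + 2 + n by ring, e2,
      show β + 1 + 1 + k = β + 1 + k + 1 by ring, e1, show β + k + 1 = β + 1 + k by ring]
    simp only [eval_comp, eval_add, eval_X, eval_C]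
    rw [show β + 1 + k + (α + 1) = α + β + k + 2 by ring]
    field_simp
  rw [scaledJacobi, integral_sum_mul_jacobiWeight hα hβ, hsum,
    Polynomial.sum_neg_one_pow_choose_mul_eval_div
      (by rw [natDegree_comp, ascPochhammer_natDegree, natDegree_X_add_C, mul_one]) hβ1]
  have e1 := Real.Gamma_add_nat_eq_ascPochhammer hβ1 (n + 1)
  have e2 := Real.Gamma_add_nat_eq_ascPochhammer hα1 n
  rw [show β + 1 + ((n + 1 : ℕ) : ℝ) = n + β + 2 by push_cast; ring] at e1
  rw [show α + 1 + n = n + α + 1 by ring] at e2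
  have hG := (Real.Gamma_pos_of_pos hβ1).ne'
  have hasc := (ascPochhammer_pos (n + 1) (β + 1) hβ1).ne'
  rw [e1, e2, Real.Gamma_nat_eq_factorial]
  simp only [eval_comp, eval_add, eval_X, eval_C, zero_add]
  field_simp

open Polynomial in
/-- The nodes of the Gauss–Jacobi rule are zeros of the Jacobi polynomial. -/
lemma eval_scaledJacobi_eq_zero_of_gaussRule {α γ : ℝ} (hα : -1 < α) (hγ : -1 < γ) {n : ℕ}
    {x w : Fin n → ℝ} (hinj : Function.Injective x)
    (hrule : ∀ p : ℝ[X], p.natDegree ≤ 2 * n - 1 →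
      ∫ t in (-1 : ℝ)..1, p.eval t * (1 - t) ^ α * (1 + t) ^ γ = ∑ i, w i * p.eval (x i))
    (i : Fin n) : (scaledJacobi α γ n).eval (x i) = 0 := by
  have hprod : (fun i => w i * (scaledJacobi α γ n).eval (x i)) = 0 := by
    refine Matrix.eq_zero_of_forall_pow_sum_mul_pow_eq_zero (f := fun i => 1 + x i)
      ((add_right_injective 1).comp hinj) fun j => ?_
    have hX : (1 + X : ℝ[X]).natDegree ≤ 1 := by compute_degree
    have hdeg : (scaledJacobi α γ n * (1 + X) ^ (j : ℕ)).natDegree ≤ 2 * n - 1 := by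
      have h1 := natDegree_mul_le_of_le (natDegree_scaledJacobi_le α γ n)
        (natDegree_pow_le_of_le (j : ℕ) hX)
      have := j.2
      omega
    rw [← integral_scaledJacobi_mul_pow_eq_zero hα hγ j.2, hrule _ hdeg]
    simp [mul_assoc]
  refine (mul_eq_zero.1 (congrFun hprod i)).resolve_left fun hwi => ?_
  set L : ℝ[X] := ∏ j ∈ Finset.univ.erase i, (X - C (x j)) with hL
  have hL0 : L ≠ 0 := Finset.prod_ne_zero_iff.2 fun j _ => X_sub_C_ne_zero _
  have hLdeg : (L ^ 2).natDegree ≤ 2 * n - 1 := by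
    have : L.natDegree = n - 1 := by
      rw [hL, natDegree_prod_of_monic _ _ fun j _ => monic_X_sub_C _]
      simp
    rw [natDegree_pow, this]
    omega
  refine (integral_sq_polynomial_mul_jacobiWeight_pos hα hγ hL0).ne' ?_
  rw [hrule _ hLdeg]
  refine Finset.sum_eq_zero fun j _ => ?_
  rcases eq_or_ne j i with rfl | hji
  · rw [hwi, zero_mul]
  · have : L.eval (x j) = 0 := by
      rw [hL, eval_prod]
      exact Finset.prod_eq_zero (Finset.mem_erase.2 ⟨hji, Finset.mem_univ _⟩) (by simp)
    simp [this]

open Polynomial in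
/-- Splitting off the value at `-1` reduces an integral with weight parameter `β` to a quadrature
rule for the parameter `β + 1`. -/
lemma integral_jacobiWeight_eq_of_rule {α β : ℝ} (hα : -1 < α) (hβ : -1 < β) {n : ℕ} (hn : 1 ≤ n)
    {x w : Fin n → ℝ} (hx : ∀ i, -1 < x i)
    (hrule : ∀ p : ℝ[X], p.natDegree ≤ 2 * n - 1 →
      ∫ t in (-1 : ℝ)..1, p.eval t * (1 - t) ^ α * (1 + t) ^ (β + 1) = ∑ i, w i * p.eval (x i))
    {p : ℝ[X]} (hp : p.natDegree ≤ 2 * n) :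
    ∫ t in (-1 : ℝ)..1, p.eval t * (1 - t) ^ α * (1 + t) ^ β
      = ((∫ t in (-1 : ℝ)..1, (1 - t) ^ α * (1 + t) ^ β) - ∑ i, w i / (1 + x i)) * p.eval (-1)
        + ∑ i, w i / (1 + x i) * p.eval (x i) := by
  set q := p /ₘ (X - C (-1)) with hq
  have hpq (t : ℝ) : p.eval t = p.eval (-1) + (1 + t) * q.eval t := by
    have h := congrArg (eval t) (modByMonic_add_div p (X - C (-1)))
    rw [modByMonic_X_sub_C_eq_C_eval] at h
    rw [← h]
    simp only [eval_add, eval_mul, eval_sub, eval_X, eval_C, ← hq]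
    ring
  have hqdeg : q.natDegree ≤ 2 * n - 1 := by
    rw [hq, natDegree_divByMonic _ (monic_X_sub_C _), natDegree_X_sub_C]
    omega
  have hcongr : ∫ t in (-1 : ℝ)..1, p.eval t * (1 - t) ^ α * (1 + t) ^ β
      = ∫ t in (-1 : ℝ)..1, (p.eval (-1) * ((1 - t) ^ α * (1 + t) ^ β)
        + q.eval t * (1 - t) ^ α * (1 + t) ^ (β + 1)) := by
    refine intervalIntegral.integral_congr_Ioo_of_le (by norm_num) fun t ht => ?_
    rw [hpq t, Real.rpow_add_one (by linarith [ht.1])]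
    ring
  rw [hcongr, intervalIntegral.integral_add
    ((intervalIntegrable_jacobiWeight hα hβ).const_mul _)
    (intervalIntegrable_polynomial_mul_jacobiWeight hα (by linarith) q),
    intervalIntegral.integral_const_mul, hrule q hqdeg]
  have hnodes : ∑ i, w i / (1 + x i) * p.eval (x i)
      = (∑ i, w i / (1 + x i)) * p.eval (-1) + ∑ i, w i * q.eval (x i) := by
    rw [Finset.sum_mul, ← Finset.sum_add_distrib]
    refine Finset.sum_congr rfl fun i _ => ?_
    have : 1 + x i ≠ 0 := by linarith [hx i]
    rw [hpq (x i)]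
    field_simp
  rw [hnodes]
  ring


theorem stmt_14 (α β : ℝ) (hα : -1 < α) (hβ : -1 < β) (n : ℕ) (hn : 1 ≤ n)
    (x : Fin n → ℝ) (hx : ∀ i, x i ∈ Ioo (-1 : ℝ) 1) (hinj : Function.Injective x)
    (wR : Fin n → ℝ)
    (hrule : ∀ p : Polynomial ℝ, p.natDegree ≤ 2 * n - 1 →
      ∫ t in (-1 : ℝ)..1, p.eval t * (1 - t) ^ α * (1 + t) ^ (β + 1)
        = ∑ i, wR i * p.eval (x i))
    (w₀ : ℝ) (hw₀ : w₀ = 2 ^ (α + β + 1) * Real.Gamma (β + 1) * Real.Gamma (β + 2)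
        * Real.Gamma ((n : ℝ) + 1) * Real.Gamma ((n : ℝ) + α + 1)
        / (Real.Gamma ((n : ℝ) + β + 2) * Real.Gamma ((n : ℝ) + α + β + 2)))
    (wt : Fin n → ℝ) (hwt : ∀ i, wt i = wR i / (1 + x i)) :
    ∀ p : Polynomial ℝ, p.natDegree ≤ 2 * n →
      ∫ t in (-1 : ℝ)..1, p.eval t * (1 - t) ^ α * (1 + t) ^ β
        = w₀ * p.eval (-1) + ∑ i, wt i * p.eval (x i) := by
  intro p hp
  have hγ : -1 < β + 1 := by linarith
  have hx' (i : Fin n) : -1 < x i := (hx i).1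
  simp only [hwt]
  rw [integral_jacobiWeight_eq_of_rule hα hβ hn hx' hrule hp]
  congr 2
  have hJ := integral_jacobiWeight_eq_of_rule hα hβ hn hx' hrule
    ((natDegree_scaledJacobi_le α (β + 1) n).trans (by omega))
  simp only [eval_scaledJacobi_eq_zero_of_gaussRule hα hγ hinj hrule, mul_zero,
    Finset.sum_const_zero, add_zero, integral_scaledJacobi_lower_weight hα hβ,
    eval_neg_one_scaledJacobi] at hJ
  have hn' : (1 : ℝ) ≤ n := by exact_mod_cast hn
  have hG1 := (Real.Gamma_pos_of_pos (show 0 < (n : ℝ) + α + β + 2 by linarith)).ne'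
  have hG2 := (Real.Gamma_pos_of_pos (show 0 < β + 2 by linarith)).ne'
  rw [show (n : ℝ) + α + (β + 1) + 1 = n + α + β + 2 by ring,
    show β + 1 + 1 = β + 2 by ring] at hJ
  rw [eq_comm, ← eq_div_iff (div_ne_zero hG1 hG2)] at hJ
  rw [hJ, hw₀]
  field_simp
end

section
/- Let α, β > −1 be real and n ≥ 1 an integer. Let x₁, …, x_n be distinct points of (−1, 1) and w₁^L, …, w_n^L real numbers such that for every real polynomial p with deg p ≤ 2n − 1, ∫_{−1}^{1} p(x)·(1 − x)^{α+1}·(1 + x)^{β+1} dx = Σ_{i=1}^n w_i^L·p(x_i). Set w₀ = 2^{α+β+1}·Γ(β + 1)·Γ(β + 2)·Γ(n + 1)·Γ(n + α + 2)/(Γ(n + β + 2)·Γ(n + α + β + 3)), w_{n+1} = 2^{α+β+1}·Γ(α + 1)·Γ(α + 2)·Γ(n + 1)·Γ(n + β + 2)/(Γ(n + α + 2)·Γ(n + α + β + 3)), and w_i = w_i^L/(1 − x_i²) for i = 1, …, n. Then for every real polynomial p with deg p ≤ 2n + 1, ∫_{−1}^{1} p(x)·(1 − x)^{α}·(1 +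 x)^{β} dx = w₀·p(−1) + Σ_{i=1}^n w_i·p(x_i) + w_{n+1}·p(1). (Gauss–Jacobi–Lobatto quadrature has maximal degree of exactness 2n + 1.) -/
open Set

/-- The Jacobi weight function is integrable. -/
theorem intervalIntegrable_jacobi_weight {a b : ℝ} (ha : -1 < a) (hb : -1 < b) :
    IntervalIntegrable (fun t : ℝ => (1 - t) ^ a * (1 + t) ^ b) MeasureTheory.volume (-1) 1 := by
  have h1 : IntervalIntegrable (fun t : ℝ => (1 + t) ^ b) MeasureTheory.volume (-1) 0 := by
    have := (intervalIntegral.intervalIntegrable_rpow' (a := 0) (b := 1) hb).comp_add_left 1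
    simpa using this
  have h2 : IntervalIntegrable (fun t : ℝ => (1 - t) ^ a) MeasureTheory.volume 0 1 := by
    have := (intervalIntegral.intervalIntegrable_rpow' (a := 1) (b := 0) ha).comp_sub_left 1
    simpa using this
  refine IntervalIntegrable.trans (b := 0) (h1.continuousOn_mul ?_) (h2.mul_continuousOn ?_)
  · intro t ht
    rw [uIcc_of_le (by norm_num)] at ht
    exact (ContinuousAt.rpow_const (by fun_prop)
      (Or.inl (by linarith [ht.2]))).continuousWithinAt
  · intro t ht
    rw [uIcc_of_le (by norm_num)] at ht
    exact (ContinuousAt.rpow_const (by fun_prop)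
      (Or.inl (by linarith [ht.1]))).continuousWithinAt

theorem intervalIntegrable_eval_mul_jacobi_weight {a b : ℝ} (ha : -1 < a) (hb : -1 < b)
    (p : Polynomial ℝ) :
    IntervalIntegrable (fun t : ℝ => p.eval t * (1 - t) ^ a * (1 + t) ^ b)
      MeasureTheory.volume (-1) 1 := by
  simpa only [mul_assoc] using
    (intervalIntegrable_jacobi_weight ha hb).continuousOn_mul p.continuous.continuousOn

/-- The total mass of the Jacobi weight function. -/
theorem integral_jacobi_weight {a b : ℝ} (ha : -1 < a) (hb : -1 < b) :
    ∫ t in (-1 : ℝ)..1, (1 - t) ^ a * (1 + t) ^ b =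
      2 ^ (a + b + 1) * Real.Gamma (a + 1) * Real.Gamma (b + 1) / Real.Gamma (a + b + 2) := by
  have hbeta : ∫ t in (0 : ℝ)..1, t ^ b * (1 - t) ^ a =
      Real.Gamma (b + 1) * Real.Gamma (a + 1) / Real.Gamma (a + b + 2) := by
    have h := Complex.betaIntegral_eq_Gamma_mul_div ((b + 1 : ℝ) : ℂ) ((a + 1 : ℝ) : ℂ)
      (by simpa using by linarith) (by simpa using by linarith)
    rw [← Complex.ofReal_add, Complex.Gamma_ofReal, Complex.Gamma_ofReal, Complex.Gamma_ofReal,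
      Complex.betaIntegral] at h
    rw [show a + b + 2 = b + 1 + (a + 1) by ring]
    apply Complex.ofReal_injective
    push_cast at h ⊢
    rw [← h, ← intervalIntegral.integral_ofReal]
    refine intervalIntegral.integral_congr_Ioo_of_le zero_le_one fun t ht => ?_
    simp only [Complex.ofReal_mul]
    rw [Complex.ofReal_cpow ht.1.le, Complex.ofReal_cpow (by linarith [ht.2])]
    push_cast
    simp
  have hsub := intervalIntegral.integral_comp_mul_sub (a := 0) (b := 1)
    (fun t : ℝ => (1 - t) ^ a * (1 + t) ^ b) (two_ne_zero) 1
  norm_num at hsub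
  have hcongr : ∫ t in (0 : ℝ)..1, (1 - (2 * t - 1)) ^ a * (2 * t) ^ b =
      ∫ t in (0 : ℝ)..1, 2 ^ (a + b) * (t ^ b * (1 - t) ^ a) := by
    refine intervalIntegral.integral_congr_Ioo_of_le zero_le_one fun t ht => ?_
    have h1t : 0 ≤ 1 - t := by linarith [ht.2]
    rw [show 1 - (2 * t - 1) = 2 * (1 - t) by ring, Real.mul_rpow zero_le_two h1t,
      Real.mul_rpow zero_le_two ht.1.le, Real.rpow_add two_pos]
    ring
  rw [hcongr, intervalIntegral.integral_const_mul, hbeta] at hsub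
  rw [Real.rpow_add_one two_ne_zero]
  linear_combination (-2) * hsub

theorem integral_eval_mul_jacobi_weight_congr {p q : Polynomial ℝ} {a b c d : ℝ}
    (h : ∀ t ∈ Ioo (-1 : ℝ) 1,
      p.eval t * (1 - t) ^ a * (1 + t) ^ b = q.eval t * (1 - t) ^ c * (1 + t) ^ d) :
    ∫ t in (-1 : ℝ)..1, p.eval t * (1 - t) ^ a * (1 + t) ^ b =
      ∫ t in (-1 : ℝ)..1, q.eval t * (1 - t) ^ c * (1 + t) ^ d :=
  intervalIntegral.integral_congr_Ioo_of_le (by norm_num) h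

theorem Real.Gamma_add_nat_eq_ascPochhammer_mul {s : ℝ} (hs : 0 < s) (n : ℕ) :
    Real.Gamma (s + n) = (ascPochhammer ℝ n).eval s * Real.Gamma s := by
  induction n with
  | zero => simp
  | succ n ih =>
    rw [Nat.cast_succ, ← add_assoc, Real.Gamma_add_one (by positivity), ih,
      ascPochhammer_succ_eval]
    ring

open Polynomial in
/-- As a function of the exponent `z`, the integral of a polynomial of degree at most `n` against
`(1 - t) ^ a * (1 + t) ^ z` is a quotient of Gamma functions times a polynomial of degree at most
`n`. -/
theorem exists_polynomial_integral_eval_mul_jacobi_weight {a : ℝ} (ha : -1 < a) {n : ℕ}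
    {l : ℝ[X]} (hl : l.natDegree ≤ n) :
    ∃ R : ℝ[X], R.natDegree ≤ n ∧
      R.eval (-1) = l.eval (-1) * (ascPochhammer ℝ n).eval (a + 1) ∧
      ∀ z : ℝ, -1 < z → ∫ t in (-1 : ℝ)..1, l.eval t * (1 - t) ^ a * (1 + t) ^ z =
        2 ^ (a + z + 1) * Real.Gamma (a + 1) * Real.Gamma (z + 1) / Real.Gamma (a + z + 2 + n) *
          R.eval z := by
  set q : ℝ[X] := l.comp (X - 1) with hq
  have hqdeg : q.natDegree < n + 1 := by
    have : q.natDegree ≤ l.natDegree * (X - 1 : ℝ[X]).natDegree := natDegree_comp_le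
    rw [show (X - 1 : ℝ[X]) = X - C 1 by simp, natDegree_X_sub_C] at this
    omega
  have heval (t : ℝ) : l.eval t = ∑ k ∈ Finset.range (n + 1), q.coeff k * (1 + t) ^ k := by
    rw [← eval_eq_sum_range' hqdeg, hq]
    simp
  refine ⟨∑ k ∈ Finset.range (n + 1), C (q.coeff k * 2 ^ k) *
    ((ascPochhammer ℝ k).comp (X + C 1) *
      (ascPochhammer ℝ (n - k)).comp (X + C (a + 2 + k))), ?_, ?_, ?_⟩
  · refine natDegree_sum_le_of_forall_le _ _ fun k hk => ?_
    refine (natDegree_C_mul_le _ _).trans (natDegree_mul_le.trans ?_)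
    rw [natDegree_comp, natDegree_comp, natDegree_X_add_C, natDegree_X_add_C,
      ascPochhammer_natDegree, ascPochhammer_natDegree]
    have := Finset.mem_range.1 hk
    omega
  · rw [eval_finsetSum, Finset.sum_range_succ', Finset.sum_eq_zero, heval,
      Finset.sum_range_succ', Finset.sum_eq_zero]
    · simp
      left
      congr 1
      ring
    · intro k _
      simp
    · intro k _
      simp
  · intro z hz
    have hterm (k : ℕ) (hk : k ∈ Finset.range (n + 1)) :
        ∫ t in (-1 : ℝ)..1, q.coeff k * ((1 - t) ^ a * (1 + t) ^ (z + k)) =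
        2 ^ (a + z + 1) * Real.Gamma (a + 1) * Real.Gamma (z + 1) / Real.Gamma (a + z + 2 + n) *
          (C (q.coeff k * 2 ^ k) * ((ascPochhammer ℝ k).comp (X + C 1) *
      (ascPochhammer ℝ (n - k)).comp (X + C (a + 2 + k)))).eval z := by
      have hkn : k ≤ n := Nat.lt_succ_iff.1 (Finset.mem_range.1 hk)
      have hk0 : (0 : ℝ) ≤ k := k.cast_nonneg
      have hpos : 0 < a + z + 2 + k := by linarith
      rw [intervalIntegral.integral_const_mul, integral_jacobi_weight ha (by linarith)]
      have h1 := Real.Gamma_add_nat_eq_ascPochhammer_mul (show 0 < z + 1 by linarith) k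
      have h2 := Real.Gamma_add_nat_eq_ascPochhammer_mul hpos (n - k)
      rw [Nat.cast_sub hkn, show a + z + 2 + k + ((n : ℝ) - k) = a + z + 2 + n by ring] at h2
      rw [show a + (z + k) + 1 = a + z + 1 + k by ring, Real.rpow_add_natCast two_ne_zero,
        show z + k + 1 = z + 1 + k by ring, h1, show a + (z + k) + 2 = a + z + 2 + k by ring, h2]
      simp only [eval_mul, eval_C, eval_comp, eval_add, eval_X]
      rw [show z + (a + 2 + k) = a + z + 2 + k by ring]
      have g1 := (Real.Gamma_pos_of_pos hpos).ne'
      have g2 := (ascPochhammer_pos (n - k) _ hpos).ne'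
      field_simp
    rw [eval_finsetSum, Finset.mul_sum, ← Finset.sum_congr rfl hterm,
      ← intervalIntegral.integral_finsetSum]
    · refine intervalIntegral.integral_congr_Ioo_of_le (by norm_num) fun t ht => ?_
      have h1t : 0 < 1 + t := by linarith [ht.1]
      simp only [heval, Finset.sum_mul]
      refine Finset.sum_congr rfl fun k _ => ?_
      rw [Real.rpow_add_natCast h1t.ne']
      ring
    · intro k _
      have hk0 : (0 : ℝ) ≤ k := k.cast_nonneg
      exact (intervalIntegrable_jacobi_weight ha (by linarith)).const_mul _

open Polynomial in
theorem eval_mul_ascPochhammer_of_roots {b : ℝ} (hb : 0 < b) {n : ℕ} {R : ℝ[X]}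
    (hR : R.natDegree ≤ n) (hroot : ∀ j : ℕ, j < n → R.eval (b + j) = 0) :
    R.eval (b - 1) * (ascPochhammer ℝ n).eval (b + 1) = n.factorial * R.eval (-1) := by
  set Q : ℝ[X] := (ascPochhammer ℝ n).comp (C b - X) with hQ
  have hQdeg : Q.natDegree ≤ n := by
    refine natDegree_comp_le.trans ?_
    rw [ascPochhammer_natDegree]
    have : (C b - X : ℝ[X]).natDegree ≤ 1 := by
      refine (natDegree_sub_le _ _).trans ?_
      simp
    nlinarith
  have hQ1 : Q.eval (-1) = (ascPochhammer ℝ n).eval (b + 1) := by simp [hQ]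
  have hQ2 : Q.eval (b - 1) = n.factorial := by simp [hQ, ascPochhammer_eval_one]
  have hzero : C (R.eval (-1)) * Q - C (Q.eval (-1)) * R = 0 := by
    refine eq_zero_of_natDegree_lt_card_of_eval_eq_zero _
      (f := fun i : Option (Fin n) => i.elim (-1 : ℝ) fun j => b + (j : ℕ)) ?_ ?_ ?_
    · rintro (_ | i) (_ | j) h
      · rfl
      · have : (0 : ℝ) ≤ (j : ℕ) := Nat.cast_nonneg _
        simp only [Option.elim] at h
        linarith
      · have : (0 : ℝ) ≤ (i : ℕ) := Nat.cast_nonneg _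
        simp only [Option.elim] at h
        linarith
      · simp only [Option.elim, add_right_inj, Nat.cast_inj] at h
        rw [Fin.ext h]
    · rintro (_ | j)
      · simp [mul_comm]
      · have := ascPochhammer_eval_neg_coe_nat_of_lt (R := ℝ) j.2
        simp [hroot j j.2, hQ, this]
    · rw [Fintype.card_option, Fintype.card_fin, Nat.lt_succ_iff]
      exact (natDegree_sub_le _ _).trans
        (max_le ((natDegree_C_mul_le _ _).trans hQdeg) ((natDegree_C_mul_le _ _).trans hR))
  have h := congrArg (eval (b - 1)) hzero
  simp only [eval_sub, eval_mul, eval_C, hQ2, hQ1, eval_zero] at h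
  linarith

/-- The integral, against the weight with the exponent at `-1` lowered by one, of a polynomial of
degree at most `n` orthogonal to all polynomials of lower degree for the Jacobi weight. -/
theorem integral_eval_mul_jacobi_weight_of_orthogonal {a b : ℝ} (ha : -1 < a) (hb : 0 < b)
    {n : ℕ} {l : Polynomial ℝ} (hl : l.natDegree ≤ n)
    (horth : ∀ j : ℕ, j < n →
      ∫ t in (-1 : ℝ)..1, l.eval t * (1 - t) ^ a * (1 + t) ^ (b + j) = 0) :
    ∫ t in (-1 : ℝ)..1, l.eval t * (1 - t) ^ a * (1 + t) ^ (b - 1) =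
      2 ^ (a + b) * Real.Gamma b * Real.Gamma (b + 1) * Real.Gamma ((n : ℝ) + 1) *
        Real.Gamma (n + a + 1) / (Real.Gamma (n + b + 1) * Real.Gamma (n + a + b + 1)) *
          l.eval (-1) := by
  obtain ⟨R, hR, hR1, hint⟩ := exists_polynomial_integral_eval_mul_jacobi_weight ha hl
  have hroot (j : ℕ) (hj : j < n) : R.eval (b + j) = 0 := by
    have hj0 : (0 : ℝ) ≤ j := j.cast_nonneg
    have h := horth j hj
    rw [hint _ (by linarith)] at h
    refine (mul_eq_zero.1 h).resolve_left (ne_of_gt ?_)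
    have hn0 : (0 : ℝ) ≤ n := n.cast_nonneg
    have g1 := Real.Gamma_pos_of_pos (show 0 < a + 1 by linarith)
    have g2 := Real.Gamma_pos_of_pos (show 0 < b + j + 1 by linarith)
    have g3 := Real.Gamma_pos_of_pos (show 0 < a + (b + j) + 2 + n by linarith)
    positivity
  have hR2 := eval_mul_ascPochhammer_of_roots hb hR hroot
  have p1 : 0 < a + 1 := by linarith
  have p2 : 0 < b + 1 := by linarith
  have p3 : 0 < (n : ℝ) + a + b + 1 := by
    have : (0 : ℝ) ≤ n := n.cast_nonneg
    linarith
  rw [hint _ (by linarith), show (n : ℝ) + a + 1 = a + 1 + n by ring,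
    show (n : ℝ) + b + 1 = b + 1 + n by ring, Real.Gamma_add_nat_eq_ascPochhammer_mul p1,
    Real.Gamma_add_nat_eq_ascPochhammer_mul p2, Real.Gamma_nat_eq_factorial,
    show a + (b - 1) + 1 = a + b by ring, show b - 1 + 1 = b by ring,
    show a + (b - 1) + 2 + n = n + a + b + 1 by ring]
  rw [hR1] at hR2
  have g2 := (Real.Gamma_pos_of_pos p2).ne'
  have g3 := (Real.Gamma_pos_of_pos p3).ne'
  have g4 := (ascPochhammer_pos n _ p2).ne'
  field_simp
  linear_combination hR2

open Polynomial in
/-- The degree-`n` nodal polynomial of a Gauss--Jacobi rule with parameters `(a, b + 1)`, integrated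
against the Jacobi weight with parameters `(a, b)`. -/
theorem integral_nodal_mul_jacobi_weight {a b : ℝ} (ha : -1 < a) (hb : -1 < b) {n : ℕ}
    (x w : Fin n → ℝ)
    (hrule : ∀ p : ℝ[X], p.natDegree ≤ 2 * n - 1 →
      ∫ t in (-1 : ℝ)..1, p.eval t * (1 - t) ^ a * (1 + t) ^ (b + 1) = ∑ i, w i * p.eval (x i)) :
    ∫ t in (-1 : ℝ)..1, (∏ i, (X - C (x i))).eval t * (1 - t) ^ a * (1 + t) ^ b =
      2 ^ (a + b + 1) * Real.Gamma (b + 1) * Real.Gamma (b + 2) * Real.Gamma ((n : ℝ) + 1) *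
        Real.Gamma (n + a + 1) / (Real.Gamma (n + b + 2) * Real.Gamma (n + a + b + 2)) *
          (∏ i, (X - C (x i))).eval (-1) := by
  set l : ℝ[X] := ∏ i, (X - C (x i)) with hl
  have hdeg : l.natDegree = n := by
    rw [hl, natDegree_finsetProd_X_sub_C_eq_card, Finset.card_univ, Fintype.card_fin]
  have hroot (i : Fin n) : l.eval (x i) = 0 := by
    rw [hl, eval_prod]
    exact Finset.prod_eq_zero (Finset.mem_univ i) (by simp)
  have h := integral_eval_mul_jacobi_weight_of_orthogonal ha (show 0 < b + 1 by linarith)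
    hdeg.le fun j hj => ?_
  · rw [show b + 1 - 1 = b by ring] at h
    rw [h, show a + (b + 1) = a + b + 1 by ring, show b + 1 + 1 = b + 2 by ring,
      show n + (b + 1) + 1 = n + b + 2 by ring, show n + a + (b + 1) + 1 = n + a + b + 2 by ring]
  · have hint := hrule (l * (X + C 1) ^ j) (by
      refine natDegree_mul_le.trans ?_
      rw [natDegree_pow, natDegree_X_add_C, hdeg]
      omega)
    rw [Finset.sum_eq_zero fun i _ => by rw [eval_mul, hroot]; ring] at hint
    rw [← hint]
    refine integral_eval_mul_jacobi_weight_congr fun t ht => ?_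
    rw [Real.rpow_add_natCast (by linarith [ht.1])]
    simp only [eval_mul, eval_pow, eval_add, eval_X, eval_C]
    ring

open Polynomial in
theorem exists_eq_mul_one_sub_X_sq {p : ℝ[X]} (h1 : p.eval 1 = 0) (h2 : p.eval (-1) = 0) :
    ∃ q : ℝ[X], p = q * (1 - X ^ 2) ∧ q.natDegree = p.natDegree - 2 := by
  have hdvd : (X - C 1) * (X - C (-1)) ∣ p :=
    (pairwise_coprime_X_sub_C Function.injective_id (show (1 : ℝ) ≠ -1 by norm_num)).mul_dvd
      (dvd_iff_isRoot.2 h1) (dvd_iff_isRoot.2 h2)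
  obtain ⟨q, hq⟩ := hdvd
  have hpq : p = -q * (1 - X ^ 2) := by
    rw [hq]
    simp only [map_neg, map_one]
    ring
  have hmonic : ((X - C 1) * (X - C (-1)) : ℝ[X]).Monic :=
    (monic_X_sub_C _).mul (monic_X_sub_C _)
  refine ⟨-q, hpq, ?_⟩
  rcases eq_or_ne q 0 with rfl | hq0
  · simp [hq]
  · rw [hq, hmonic.natDegree_mul' hq0, (monic_X_sub_C _).natDegree_mul (monic_X_sub_C _),
      natDegree_X_sub_C, natDegree_X_sub_C, natDegree_neg]
    omega

open Set

theorem stmt_16 (α β : ℝ) (hα : -1 < α) (hβ : -1 < β) (n : ℕ) (hn : 1 ≤ n)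
    (x : Fin n → ℝ) (hx : ∀ i, x i ∈ Ioo (-1 : ℝ) 1) (hinj : Function.Injective x)
    (wL : Fin n → ℝ)
    (hrule : ∀ p : Polynomial ℝ, p.natDegree ≤ 2 * n - 1 →
      ∫ t in (-1 : ℝ)..1, p.eval t * (1 - t) ^ (α + 1) * (1 + t) ^ (β + 1)
        = ∑ i, wL i * p.eval (x i))
    (w₀ : ℝ) (hw₀ : w₀ = 2 ^ (α + β + 1) * Real.Gamma (β + 1) * Real.Gamma (β + 2)
        * Real.Gamma ((n : ℝ) + 1) * Real.Gamma ((n : ℝ) + α + 2)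
        / (Real.Gamma ((n : ℝ) + β + 2) * Real.Gamma ((n : ℝ) + α + β + 3)))
    (wn1 : ℝ) (hwn1 : wn1 = 2 ^ (α + β + 1) * Real.Gamma (α + 1) * Real.Gamma (α + 2)
        * Real.Gamma ((n : ℝ) + 1) * Real.Gamma ((n : ℝ) + β + 2)
        / (Real.Gamma ((n : ℝ) + α + 2) * Real.Gamma ((n : ℝ) + α + β + 3)))
    (wt : Fin n → ℝ) (hwt : ∀ i, wt i = wL i / (1 - (x i) ^ 2)) :
    ∀ p : Polynomial ℝ, p.natDegree ≤ 2 * n + 1 →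
      ∫ t in (-1 : ℝ)..1, p.eval t * (1 - t) ^ α * (1 + t) ^ β
        = w₀ * p.eval (-1) + (∑ i, wt i * p.eval (x i)) + wn1 * p.eval 1 := by
  intro p hp
  set l : Polynomial ℝ := ∏ i, (Polynomial.X - Polynomial.C (x i)) with hl
  have hdeg : l.natDegree = n := by
    rw [hl, Polynomial.natDegree_finsetProd_X_sub_C_eq_card, Finset.card_univ, Fintype.card_fin]
  have hroot (i : Fin n) : l.eval (x i) = 0 := by
    rw [hl, Polynomial.eval_prod]
    exact Finset.prod_eq_zero (Finset.mem_univ i) (by simp)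
  have hl1 : l.eval 1 ≠ 0 := by
    rw [hl, Polynomial.eval_prod]
    refine Finset.prod_ne_zero_iff.2 fun i _ => ?_
    rw [Polynomial.eval_sub, Polynomial.eval_X, Polynomial.eval_C]
    linarith [(hx i).2]
  have hl2 : l.eval (-1) ≠ 0 := by
    rw [hl, Polynomial.eval_prod]
    refine Finset.prod_ne_zero_iff.2 fun i _ => ?_
    rw [Polynomial.eval_sub, Polynomial.eval_X, Polynomial.eval_C]
    linarith [(hx i).1]
  have hleft : ∫ t in (-1 : ℝ)..1, l.eval t * (1 - t) ^ (α + 1) * (1 + t) ^ β =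
      2 * w₀ * l.eval (-1) := by
    rw [hl, integral_nodal_mul_jacobi_weight (by linarith) hβ x wL hrule, hw₀,
      show α + 1 + β + 1 = α + β + 1 + 1 by ring, Real.rpow_add_one two_ne_zero,
      show (n : ℝ) + (α + 1) + 1 = n + α + 2 by ring,
      show (n : ℝ) + (α + 1) + β + 2 = n + α + β + 3 by ring]
    ring
  have hright : ∫ t in (-1 : ℝ)..1, l.eval t * (1 - t) ^ α * (1 + t) ^ (β + 1) =
      2 * wn1 * l.eval 1 := by
    have hrefl (t : ℝ) : (∏ i, (Polynomial.X - Polynomial.C (-x i))).eval t =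
        (-1) ^ n * l.eval (-t) := by
      have hprod : ∏ i : Fin n, (-1 : ℝ) = (-1) ^ n := by simp
      rw [hl, Polynomial.eval_prod, Polynomial.eval_prod, ← hprod, ← Finset.prod_mul_distrib]
      refine Finset.prod_congr rfl fun i _ => ?_
      simp only [Polynomial.eval_sub, Polynomial.eval_X, Polynomial.eval_C]
      ring
    have h := integral_nodal_mul_jacobi_weight (a := β + 1) (by linarith) hα (fun i => -x i) wL
      fun p hp => by
        have hr := hrule (p.comp (-Polynomial.X)) (by
          refine Polynomial.natDegree_comp_le.trans ?_
          rwa [Polynomial.natDegree_neg, Polynomial.natDegree_X, mul_one])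
        simp only [Polynomial.eval_comp, Polynomial.eval_neg, Polynomial.eval_X] at hr
        rw [← hr, ← neg_neg (1 : ℝ), ← intervalIntegral.integral_comp_neg, neg_neg]
        refine intervalIntegral.integral_congr fun t _ => ?_
        simp only [sub_neg_eq_add, ← sub_eq_add_neg]
        ring
    simp only [hrefl, neg_neg] at h
    have hflip : ∫ t in (-1 : ℝ)..1, (-1) ^ n * l.eval (-t) * (1 - t) ^ (β + 1) * (1 + t) ^ α =
        (-1) ^ n * ∫ t in (-1 : ℝ)..1, l.eval t * (1 - t) ^ α * (1 + t) ^ (β + 1) := by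
      rw [← intervalIntegral.integral_const_mul]
      have := intervalIntegral.integral_comp_neg (a := -1) (b := 1)
        fun t : ℝ => (-1) ^ n * (l.eval t * (1 - t) ^ α * (1 + t) ^ (β + 1))
      rw [neg_neg] at this
      rw [← this]
      refine intervalIntegral.integral_congr fun t _ => ?_
      simp only [sub_neg_eq_add, ← sub_eq_add_neg]
      ring
    rw [hflip] at h
    have hsign : ((-1 : ℝ) ^ n) ≠ 0 := by positivity
    apply mul_left_cancel₀ hsign
    rw [h, hwn1,
      show β + 1 + α + 1 = α + β + 1 + 1 by ring, Real.rpow_add_one two_ne_zero,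
      show (n : ℝ) + (β + 1) + 1 = n + β + 2 by ring,
      show (n : ℝ) + (β + 1) + α + 2 = n + α + β + 3 by ring]
    ring
  set u : ℝ := p.eval (-1) / (2 * l.eval (-1)) with hu
  set v : ℝ := p.eval 1 / (2 * l.eval 1) with hv
  have hu' : 2 * u * l.eval (-1) = p.eval (-1) := by
    rw [hu]
    field_simp
  have hv' : 2 * v * l.eval 1 = p.eval 1 := by
    rw [hv]
    field_simp
  set r : Polynomial ℝ := Polynomial.C u * ((1 - Polynomial.X) * l) +
    Polynomial.C v * ((1 + Polynomial.X) * l) with hr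
  have hrdeg : r.natDegree ≤ 2 * n + 1 := by
    have h1 : (1 - Polynomial.X : Polynomial ℝ).natDegree ≤ 1 := by compute_degree
    have h2 : (1 + Polynomial.X : Polynomial ℝ).natDegree ≤ 1 := by compute_degree
    refine Polynomial.natDegree_add_le_of_degree_le ?_ ?_
    · refine (Polynomial.natDegree_C_mul_le _ _).trans (Polynomial.natDegree_mul_le.trans ?_)
      omega
    · refine (Polynomial.natDegree_C_mul_le _ _).trans (Polynomial.natDegree_mul_le.trans ?_)
      omega
  have hreval (t : ℝ) : r.eval t = u * ((1 - t) * l.eval t) + v * ((1 + t) * l.eval t) := by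
    simp [hr]
  obtain ⟨q, hq, hqdeg⟩ := exists_eq_mul_one_sub_X_sq (p := p - r)
    (by rw [Polynomial.eval_sub, hreval]; linear_combination -hv')
    (by rw [Polynomial.eval_sub, hreval]; linear_combination -hu')
  have hpr : (p - r).natDegree ≤ 2 * n + 1 :=
    (Polynomial.natDegree_sub_le _ _).trans (max_le hp hrdeg)
  have hpeval (t : ℝ) : p.eval t =
      q.eval t * (1 - t ^ 2) + (u * ((1 - t) * l.eval t) + v * ((1 + t) * l.eval t)) := by
    have h := congrArg (Polynomial.eval t) hq
    simp only [Polynomial.eval_sub, Polynomial.eval_mul, Polynomial.eval_one, Polynomial.eval_pow,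
      Polynomial.eval_X, hreval] at h
    linear_combination h
  have hsplit : ∫ t in (-1 : ℝ)..1, p.eval t * (1 - t) ^ α * (1 + t) ^ β =
      (∫ t in (-1 : ℝ)..1, q.eval t * (1 - t) ^ (α + 1) * (1 + t) ^ (β + 1)) +
      (u * (∫ t in (-1 : ℝ)..1, l.eval t * (1 - t) ^ (α + 1) * (1 + t) ^ β) +
      v * ∫ t in (-1 : ℝ)..1, l.eval t * (1 - t) ^ α * (1 + t) ^ (β + 1)) := by
    have hα' : -1 < α + 1 := by linarith
    have hβ' : -1 < β + 1 := by linarith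
    have i1 := intervalIntegrable_eval_mul_jacobi_weight hα' hβ' q
    have i2 := (intervalIntegrable_eval_mul_jacobi_weight hα' hβ l).const_mul u
    have i3 := (intervalIntegrable_eval_mul_jacobi_weight hα hβ' l).const_mul v
    rw [← intervalIntegral.integral_const_mul, ← intervalIntegral.integral_const_mul,
      ← intervalIntegral.integral_add i2 i3, ← intervalIntegral.integral_add i1 (i2.add i3)]
    refine intervalIntegral.integral_congr_Ioo_of_le (by norm_num) fun t ht => ?_
    have ht1 : 1 + t ≠ 0 := by linarith [ht.1]
    have ht2 : 1 - t ≠ 0 := by linarith [ht.2]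
    simp only [hpeval, Real.rpow_add_one ht1, Real.rpow_add_one ht2]
    ring
  have hsum : ∑ i, wt i * p.eval (x i) = ∑ i, wL i * q.eval (x i) := by
    refine Finset.sum_congr rfl fun i _ => ?_
    have hne : 1 - x i ^ 2 ≠ 0 := by nlinarith [(hx i).1, (hx i).2]
    rw [hpeval, hroot, hwt]
    field_simp
    ring
  rw [hsplit, hrule q (by omega), hleft, hright, hsum]
  linear_combination w₀ * hu' + wn1 * hv'
end
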